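/- arXiv:1807.09485 — 5 statements merged into one kernel-verified Lean document; each statement's English description precedes it below -/
import Mathlib

section
/- Fix n ≥ 1. The 2n+1 functions E_0^1, E_1^1, …, E_n^1, E_0^0, E_1^0, …, E_{n−1}^0, regarded as functions from the positive integers to ℚ, are linearly independent over ℚ. -/
open Pointwise

/-- A unimodular transformation of `ℝ^n`: an affine map `x ↦ A·x + b` with
`A ∈ GL_n(ℤ)` and `b ∈ ℤ^n`. -/
def IsUnimodular {n : ℕ} (f : (Fin n → ℝ) → (Fin n → ℝ)) : Prop :=
  ∃ A : Matrix (Fin n) (Fin n) ℤ, IsUnit A.det ∧ ∃ b : Fin n → ℤ,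
    ∀ x, f x = (A.map (Int.cast : ℤ → ℝ)).mulVec x + fun i => (b i : ℝ)

/-- `conv(0, e_1, …, e_i)` in `ℝ^n`, where `e_1, …, e_n` is the standard basis. -/
def baseSimplex (n i : ℕ) : Set (Fin n → ℝ) :=
  convexHull ℝ (insert 0 ((fun j : Fin n => (Pi.single j 1 : Fin n → ℝ)) '' {j | (j : ℕ) < i}))

/-- A half-unimodular simplex: a set `Δ` such that `2Δ` is the image of some
`conv(0, e_1, …, e_i)` under a unimodular transformation. -/
def IsHalfUnimodular {n : ℕ} (Δ : Set (Fin n → ℝ)) : Prop :=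
  ∃ i ≤ n, ∃ f, IsUnimodular f ∧ (2 : ℝ) • Δ = f '' baseSimplex n i

/-- The number of lattice points in a subset of `ℝ^n`. -/
noncomputable def latticeCount {n : ℕ} (S : Set (Fin n → ℝ)) : ℕ :=
  Set.ncard {x : Fin n → ℤ | (fun i => (x i : ℝ)) ∈ S}

/-- `Δ_i^1 = ½·conv(0, e_1, …, e_i)` in `ℝ^n`. -/
noncomputable def Δone (n i : ℕ) : Set (Fin n → ℝ) := (2⁻¹ : ℝ) • baseSimplex n i

/-- `Δ_i^0 = ½·conv(e_1, …, e_{i+1})` in `ℝ^n`. -/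
noncomputable def Δzero (n i : ℕ) : Set (Fin n → ℝ) :=
  (2⁻¹ : ℝ) •
    convexHull ℝ ((fun j : Fin n => (Pi.single j 1 : Fin n → ℝ)) '' {j | (j : ℕ) < i + 1})

/-- `E_i^1(k)`: the number of lattice points in the relative interior of `k·Δ_i^1`. -/
noncomputable def Eone (n i k : ℕ) : ℕ :=
  latticeCount (intrinsicInterior ℝ ((k : ℝ) • Δone n i))

/-- `E_i^0(k)`: the number of lattice points in the relative interior of `k·Δ_i^0`. -/
noncomputable def Ezero (n i k : ℕ) : ℕ :=
  latticeCount (intrinsicInterior ℝ ((k : ℝ) • Δzero n i))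

section IntrinsicInterior

variable {E : Type*} [NormedAddCommGroup E] [NormedSpace ℝ E]

/-- A linear functional bounded above by `b` on `S`, and not identically `b` there, is strictly
less than `b` on the relative interior. -/
theorem lt_of_mem_intrinsicInterior {S : Set E} {x p : E} (hx : x ∈ intrinsicInterior ℝ S)
    (f : E →ₗ[ℝ] ℝ) {b : ℝ} (hf : ∀ y ∈ S, f y ≤ b) (hp : p ∈ S) (hpb : f p < b) : f x < b := by
  obtain ⟨y, hy, rfl⟩ := mem_intrinsicInterior.1 hx
  have hpS : p ∈ affineSpan ℝ S := subset_affineSpan ℝ S hp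
  let γ : ℝ → affineSpan ℝ S := fun t =>
    ⟨AffineMap.lineMap p (y : E) t, AffineMap.lineMap_mem t hpS y.2⟩
  have hγ : Continuous γ := by
    refine Continuous.subtype_mk ?_ _
    exact AffineMap.lineMap_continuous
  have h1 : γ 1 = y := Subtype.ext (AffineMap.lineMap_apply_one _ _)
  have hmem : ∀ᶠ t in nhds (1 : ℝ), γ t ∈ ((↑) ⁻¹' S : Set (affineSpan ℝ S)) :=
    hγ.continuousAt.eventually (by rw [h1]; exact mem_interior_iff_mem_nhds.1 hy)
  obtain ⟨t, ht, ht1⟩ :=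
    ((hmem.filter_mono nhdsWithin_le_nhds).and self_mem_nhdsWithin :
      ∀ᶠ t in nhdsWithin (1 : ℝ) (Set.Ioi 1), _ ∧ t ∈ Set.Ioi (1 : ℝ)).exists
  have hle : f (AffineMap.lineMap p (y : E) t) ≤ b := hf _ ht
  rw [AffineMap.lineMap_apply_module, map_add, map_smul, map_smul, smul_eq_mul,
    smul_eq_mul] at hle
  have ht1 : 1 < t := ht1
  by_contra! hb
  nlinarith

theorem mem_intrinsicInterior_of_isOpen {S U : Set E} {x : E} (hU : IsOpen U) (hxU : x ∈ U)
    (hxS : x ∈ S) (h : ∀ y ∈ affineSpan ℝ S, y ∈ U → y ∈ S) : x ∈ intrinsicInterior ℝ S :=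
  mem_intrinsicInterior.2 ⟨⟨x, subset_affineSpan ℝ S hxS⟩,
    mem_interior.2 ⟨((↑) : affineSpan ℝ S → E) ⁻¹' U, fun y hy => h y y.2 hy, hU.preimage continuous_subtype_val, hxU⟩,
    rfl⟩

theorem eq_of_mem_affineSpan {S : Set E} (f : E →ₗ[ℝ] ℝ) {b : ℝ} (hf : ∀ y ∈ S, f y = b) {x : E}
    (hx : x ∈ affineSpan ℝ S) : f x = b := by
  refine affineSpan_induction (p := fun y => f y = b) hx hf fun c u v w hu hv hw => ?_
  simp [hu, hv, hw]

end IntrinsicInterior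

section Simplices

variable {n : ℕ}

theorem convexHull_single_image_eq (s : Set (Fin n)) :
    convexHull ℝ ((fun j : Fin n => (Pi.single j 1 : Fin n → ℝ)) '' s) =
      {x | (∀ j, 0 ≤ x j) ∧ (∀ j ∉ s, x j = 0) ∧ ∑ j, x j = 1} := by
  classical
  apply subset_antisymm
  · refine convexHull_min ?_ ?_
    · rintro _ ⟨j, hj, rfl⟩
      refine ⟨fun l => ?_, fun l hl => ?_, by simp⟩
      · by_cases h : l = j
        · subst h; simp
        · simp [h]
      · have : l ≠ j := fun h => hl (h ▸ hj)
        simp [this]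
    · rintro x ⟨hx, hx0, hxs⟩ y ⟨hy, hy0, hys⟩ a b ha hb hab
      refine ⟨fun j => ?_, fun j hj => ?_, ?_⟩
      · have := hx j
        have := hy j
        simp only [Pi.add_apply, Pi.smul_apply, smul_eq_mul]
        positivity
      · simp [hx0 j hj, hy0 j hj]
      · simp [Finset.sum_add_distrib, ← Finset.mul_sum, hxs, hys, hab]
  · rintro x ⟨hx, hx0, hxs⟩
    have hsum : ∑ j ∈ Finset.univ.filter (· ∈ s), x j = 1 := by
      rw [← hxs]
      exact Finset.sum_subset (Finset.filter_subset _ _) fun j _ hj => hx0 j (by simpa using hj)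
    have hx' : ∑ j ∈ Finset.univ.filter (· ∈ s), x j • (Pi.single j 1 : Fin n → ℝ) = x := by
      rw [Finset.sum_subset (Finset.filter_subset _ _) fun j _ hj => by
        rw [hx0 j (by simpa using hj), zero_smul]]
      ext l
      simp [Finset.sum_apply, Pi.single_apply]
    rw [← hx']
    exact (convex_convexHull ℝ _).sum_mem (fun j _ => hx j) hsum fun j hj =>
      subset_convexHull ℝ _ ⟨j, by simpa using hj, rfl⟩

theorem convexHull_insert_zero_single_image_eq (s : Set (Fin n)) :
    convexHull ℝ (insert 0 ((fun j : Fin n => (Pi.single j 1 : Fin n → ℝ)) '' s)) =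
      {x | (∀ j, 0 ≤ x j) ∧ (∀ j ∉ s, x j = 0) ∧ ∑ j, x j ≤ 1} := by
  apply subset_antisymm
  · refine convexHull_min ?_ ?_
    · refine Set.insert_subset (by simp) fun y hy => ?_
      have := subset_convexHull ℝ _ hy
      rw [convexHull_single_image_eq] at this
      exact ⟨this.1, this.2.1, this.2.2.le⟩
    · rintro x ⟨hx, hx0, hxs⟩ y ⟨hy, hy0, hys⟩ a b ha hb hab
      refine ⟨fun j => ?_, fun j hj => ?_, ?_⟩
      · have := hx j
        have := hy j
        simp only [Pi.add_apply, Pi.smul_apply, smul_eq_mul]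
        positivity
      · simp [hx0 j hj, hy0 j hj]
      · simp only [Pi.add_apply, Pi.smul_apply, smul_eq_mul, Finset.sum_add_distrib,
          ← Finset.mul_sum]
        nlinarith
  · rintro x ⟨hx, hx0, hxs⟩
    have hzero : (0 : Fin n → ℝ) ∈
        convexHull ℝ (insert 0 ((fun j : Fin n => (Pi.single j 1 : Fin n → ℝ)) '' s)) :=
      subset_convexHull ℝ _ (Set.mem_insert _ _)
    have hnonneg : 0 ≤ ∑ j, x j := Finset.sum_nonneg fun j _ => hx j
    rcases hnonneg.eq_or_lt with h | h
    · have : x = 0 := by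
        ext j
        exact (Finset.sum_eq_zero_iff_of_nonneg fun j _ => hx j).1 h.symm j (Finset.mem_univ j)
      rwa [this]
    · have hface : (∑ j, x j)⁻¹ • x ∈
          convexHull ℝ ((fun j : Fin n => (Pi.single j 1 : Fin n → ℝ)) '' s) := by
        rw [convexHull_single_image_eq]
        refine ⟨fun j => ?_, fun j hj => by simp [hx0 j hj], ?_⟩
        · have := hx j
          simp only [Pi.smul_apply, smul_eq_mul]
          positivity
        · simp [← Finset.mul_sum, h.ne']
      have := (convex_convexHull ℝ _).smul_mem_of_zero_mem hzero
        (convexHull_mono (Set.subset_insert _ _) hface) ⟨hnonneg, hxs⟩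
      rwa [smul_inv_smul₀ h.ne'] at this

theorem smul_Δone_eq {i k : ℕ} (hk : 1 ≤ k) :
    (k : ℝ) • Δone n i =
      {x | (∀ j, 0 ≤ x j) ∧ (∀ j : Fin n, i ≤ j → x j = 0) ∧ ∑ j, x j ≤ (k : ℝ) / 2} := by
  have hk' : (0 : ℝ) < k := by exact_mod_cast hk
  ext x
  rw [Δone, baseSimplex, smul_smul, convexHull_insert_zero_single_image_eq,
    Set.mem_smul_set_iff_inv_smul_mem₀ (by positivity)]
  simp only [Set.mem_ofPred_eq, Pi.smul_apply, smul_eq_mul, ← Finset.mul_sum, not_lt]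
  refine and_congr (forall_congr' fun j => ?_) (and_congr (forall₂_congr fun j _ => ?_) ?_)
  · exact mul_nonneg_iff_of_pos_left (by positivity)
  · simp [hk'.ne']
  · rw [inv_mul_le_iff₀ (by positivity), mul_one, div_eq_mul_inv]

theorem smul_Δzero_eq {i k : ℕ} (hk : 1 ≤ k) :
    (k : ℝ) • Δzero n i =
      {x | (∀ j, 0 ≤ x j) ∧ (∀ j : Fin n, i + 1 ≤ j → x j = 0) ∧ ∑ j, x j = (k : ℝ) / 2} := by
  have hk' : (0 : ℝ) < k := by exact_mod_cast hk
  ext x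
  rw [Δzero, smul_smul, convexHull_single_image_eq,
    Set.mem_smul_set_iff_inv_smul_mem₀ (by positivity)]
  simp only [Set.mem_ofPred_eq, Pi.smul_apply, smul_eq_mul, ← Finset.mul_sum, not_lt]
  refine and_congr (forall_congr' fun j => ?_) (and_congr (forall₂_congr fun j _ => ?_) ?_)
  · exact mul_nonneg_iff_of_pos_left (by positivity)
  · simp [hk'.ne']
  · rw [inv_mul_eq_iff_eq_mul₀ (by positivity), mul_one, div_eq_mul_inv]

/-- The sum of the coordinates, as a linear functional. -/
noncomputable def coordSum (n : ℕ) : (Fin n → ℝ) →ₗ[ℝ] ℝ := ∑ j, LinearMap.proj j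

@[simp]
theorem coordSum_apply (x : Fin n → ℝ) : coordSum n x = ∑ j, x j := by
  simp [coordSum]

theorem intrinsicInterior_smul_Δone {i k : ℕ} (hk : 1 ≤ k) :
    intrinsicInterior ℝ ((k : ℝ) • Δone n i) =
      {x | (∀ j : Fin n, j < i → 0 < x j) ∧ (∀ j : Fin n, i ≤ j → x j = 0) ∧
        ∑ j, x j < (k : ℝ) / 2} := by
  have hk' : (0 : ℝ) < k := by exact_mod_cast hk
  rw [smul_Δone_eq hk]
  ext x
  constructor
  · intro hx
    refine ⟨fun l hl => ?_, (intrinsicInterior_subset hx).2.1, ?_⟩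
    · have := lt_of_mem_intrinsicInterior (p := Pi.single l ((k : ℝ) / 2)) hx
        (-LinearMap.proj l) (b := 0) (fun y hy => by simpa using hy.1 l) ?_ (by simpa using hk')
      · simpa using this
      · have hp : (0 : Fin n → ℝ) ≤ Pi.single l ((k : ℝ) / 2) :=
          Pi.single_nonneg.2 (by positivity)
        refine ⟨hp, fun j hj => ?_, by simp⟩
        simp [show j ≠ l by rintro rfl; omega]
    · simpa using lt_of_mem_intrinsicInterior (p := 0) hx (coordSum n) (b := k / 2)
        (fun y hy => by simpa using hy.2.2) (by simp; positivity) (by simpa using hk')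
  · rintro ⟨hpos, hzero, hsum⟩
    have hnonneg : ∀ y : Fin n → ℝ, (∀ j : Fin n, j < i → 0 < y j) →
        (∀ j : Fin n, i ≤ j → y j = 0) → ∀ j, 0 ≤ y j := fun y h h' j =>
      (lt_or_ge (j : ℕ) i).elim (fun hj => (h j hj).le) fun hj => (h' j hj).ge
    refine mem_intrinsicInterior_of_isOpen
      (U := {y : Fin n → ℝ | (∀ j : Fin n, j < i → 0 < y j) ∧ ∑ j, y j < (k : ℝ) / 2}) ?_ ⟨hpos, hsum⟩
      ⟨hnonneg x hpos hzero, hzero, hsum.le⟩ ?_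
    · simp only [Set.ofPred_and, Set.ofPred_forall]
      refine (isOpen_iInter_of_finite fun j => isOpen_iInter_of_finite fun _ => ?_).inter ?_
      · exact isOpen_lt continuous_const (continuous_apply j)
      · exact isOpen_lt (by fun_prop) continuous_const
    · rintro y hy ⟨hypos, hysum⟩
      have hy0 : ∀ j : Fin n, i ≤ j → y j = 0 := fun j hj =>
        eq_of_mem_affineSpan (LinearMap.proj j) (fun z hz => hz.2.1 j hj) hy
      exact ⟨hnonneg y hypos hy0, hy0, hysum.le⟩

theorem intrinsicInterior_smul_Δzero {i k : ℕ} (hk : 1 ≤ k) :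
    intrinsicInterior ℝ ((k : ℝ) • Δzero n i) =
      {x | (∀ j : Fin n, j < i + 1 → 0 < x j) ∧ (∀ j : Fin n, i + 1 ≤ j → x j = 0) ∧
        ∑ j, x j = (k : ℝ) / 2} := by
  have hk' : (0 : ℝ) < k := by exact_mod_cast hk
  rw [smul_Δzero_eq hk]
  ext x
  constructor
  · intro hx
    refine ⟨fun l hl => ?_, (intrinsicInterior_subset hx).2⟩
    have := lt_of_mem_intrinsicInterior (p := Pi.single l ((k : ℝ) / 2)) hx
      (-LinearMap.proj l) (b := 0) (fun y hy => by simpa using hy.1 l) ?_ (by simpa using hk')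
    · simpa using this
    · have hp : (0 : Fin n → ℝ) ≤ Pi.single l ((k : ℝ) / 2) :=
        Pi.single_nonneg.2 (by positivity)
      refine ⟨hp, fun j hj => ?_, by simp⟩
      simp [show j ≠ l by rintro rfl; omega]
  · rintro ⟨hpos, hzero, hsum⟩
    have hnonneg : ∀ y : Fin n → ℝ, (∀ j : Fin n, j < i + 1 → 0 < y j) →
        (∀ j : Fin n, i + 1 ≤ j → y j = 0) → ∀ j, 0 ≤ y j := fun y h h' j =>
      (lt_or_ge (j : ℕ) (i + 1)).elim (fun hj => (h j hj).le) fun hj => (h' j hj).ge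
    refine mem_intrinsicInterior_of_isOpen
      (U := {y : Fin n → ℝ | ∀ j : Fin n, j < i + 1 → 0 < y j}) ?_ hpos
      ⟨hnonneg x hpos hzero, hzero, hsum⟩ ?_
    · simp only [Set.ofPred_forall]
      exact isOpen_iInter_of_finite fun j => isOpen_iInter_of_finite fun _ =>
        isOpen_lt continuous_const (continuous_apply j)
    · intro y hy hypos
      have hy0 : ∀ j : Fin n, i + 1 ≤ j → y j = 0 := fun j hj =>
        eq_of_mem_affineSpan (LinearMap.proj j) (fun z hz => hz.2.1 j hj) hy
      refine ⟨hnonneg y hypos hy0, hy0, ?_⟩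
      rw [← coordSum_apply]
      exact eq_of_mem_affineSpan (coordSum n) (fun z hz => by simpa using hz.2.2) hy

end Simplices

section Counting

variable {n : ℕ}

theorem Eone_eq_ncard {i k : ℕ} (hk : 1 ≤ k) :
    Eone n i k = Set.ncard {x : Fin n → ℤ | (∀ j : Fin n, j < i → 0 < x j) ∧
      (∀ j : Fin n, i ≤ j → x j = 0) ∧ 2 * ∑ j, x j < k} := by
  rw [Eone, latticeCount, intrinsicInterior_smul_Δone hk]
  congr 1
  ext x
  simp only [Set.mem_ofPred_eq, Int.cast_pos, Int.cast_eq_zero]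
  rw [lt_div_iff₀' two_pos]
  norm_cast

theorem Ezero_eq_ncard {i k : ℕ} (hk : 1 ≤ k) :
    Ezero n i k = Set.ncard {x : Fin n → ℤ | (∀ j : Fin n, j < i + 1 → 0 < x j) ∧
      (∀ j : Fin n, i + 1 ≤ j → x j = 0) ∧ 2 * ∑ j, x j = k} := by
  rw [Ezero, latticeCount, intrinsicInterior_smul_Δzero hk]
  congr 1
  ext x
  simp only [Set.mem_ofPred_eq, Int.cast_pos, Int.cast_eq_zero]
  rw [eq_div_iff two_ne_zero, mul_comm]
  norm_cast

theorem sum_ite_val_lt {i : ℕ} (hi : i ≤ n) :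
    ∑ j : Fin n, (if (j : ℕ) < i then (1 : ℤ) else 0) = i := by
  simp [Finset.sum_boole, Fin.card_filter_val_lt, hi]

theorem ite_val_lt_le {i : ℕ} {x : Fin n → ℤ} (hpos : ∀ j : Fin n, j < i → 0 < x j)
    (hzero : ∀ j : Fin n, i ≤ j → x j = 0) (j : Fin n) :
    (if (j : ℕ) < i then (1 : ℤ) else 0) ≤ x j := by
  split_ifs with h
  · exact hpos j h
  · exact (hzero j (not_lt.1 h)).ge

theorem le_sum_of_pos {i : ℕ} (hi : i ≤ n) {x : Fin n → ℤ}
    (hpos : ∀ j : Fin n, j < i → 0 < x j) (hzero : ∀ j : Fin n, i ≤ j → x j = 0) :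
    (i : ℤ) ≤ ∑ j, x j :=
  (sum_ite_val_lt hi).symm.trans_le (Finset.sum_le_sum fun j _ => ite_val_lt_le hpos hzero j)

theorem eq_ite_of_sum_le {i : ℕ} (hi : i ≤ n) {x : Fin n → ℤ}
    (hpos : ∀ j : Fin n, j < i → 0 < x j) (hzero : ∀ j : Fin n, i ≤ j → x j = 0)
    (hsum : ∑ j, x j ≤ i) : x = fun j : Fin n => if (j : ℕ) < i then (1 : ℤ) else 0 := by
  have h := (Finset.sum_eq_sum_iff_of_le fun j (_ : j ∈ Finset.univ) =>
    ite_val_lt_le hpos hzero j).1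
      ((sum_ite_val_lt hi).trans (le_antisymm (le_sum_of_pos hi hpos hzero) hsum))
  ext j
  exact (h j (Finset.mem_univ j)).symm

theorem Eone_odd_eq_zero {i m : ℕ} (hi : i ≤ n) (hm : m < i) : Eone n i (2 * m + 1) = 0 := by
  rw [Eone_eq_ncard (by omega)]
  convert Set.ncard_empty (Fin n → ℤ)
  refine Set.eq_empty_of_forall_notMem fun x ⟨hpos, hzero, hsum⟩ => ?_
  have := le_sum_of_pos hi hpos hzero
  push_cast at hsum
  omega

theorem Eone_odd_self {i : ℕ} (hi : i ≤ n) : Eone n i (2 * i + 1) = 1 := by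
  rw [Eone_eq_ncard (by omega), Set.ncard_eq_one]
  refine ⟨fun j : Fin n => if (j : ℕ) < i then (1 : ℤ) else 0,
    Set.eq_singleton_iff_unique_mem.2 ⟨⟨fun j hj => ?_, fun j hj => ?_, ?_⟩, ?_⟩⟩
  · simp [hj]
  · simp [hj]
  · rw [sum_ite_val_lt hi]
    push_cast
    omega
  · rintro x ⟨hpos, hzero, hsum⟩
    push_cast at hsum
    exact eq_ite_of_sum_le hi hpos hzero (by omega)

theorem Ezero_odd_eq_zero {i m : ℕ} : Ezero n i (2 * m + 1) = 0 := by
  rw [Ezero_eq_ncard (by omega)]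
  convert Set.ncard_empty (Fin n → ℤ)
  refine Set.eq_empty_of_forall_notMem fun x ⟨_, _, hsum⟩ => ?_
  push_cast at hsum
  omega

theorem Ezero_even_eq_zero {i m : ℕ} (hi : i < n) (hm : m < i) :
    Ezero n i (2 * (m + 1)) = 0 := by
  rw [Ezero_eq_ncard (by omega)]
  convert Set.ncard_empty (Fin n → ℤ)
  refine Set.eq_empty_of_forall_notMem fun x ⟨hpos, hzero, hsum⟩ => ?_
  have := le_sum_of_pos hi hpos hzero
  push_cast at hsum this
  omega

theorem Ezero_even_self {i : ℕ} (hi : i < n) : Ezero n i (2 * (i + 1)) = 1 := by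
  rw [Ezero_eq_ncard (by omega), Set.ncard_eq_one]
  refine ⟨fun j : Fin n => if (j : ℕ) < i + 1 then (1 : ℤ) else 0,
    Set.eq_singleton_iff_unique_mem.2 ⟨⟨fun j hj => ?_, fun j hj => ?_, ?_⟩, ?_⟩⟩
  · simp [hj]
  · simp [Nat.lt_succ_iff.not.2 (not_le.2 hj)]
  · rw [sum_ite_val_lt hi]
    push_cast
    ring
  · rintro x ⟨hpos, hzero, hsum⟩
    push_cast at hsum
    exact eq_ite_of_sum_le hi hpos hzero (by push_cast; omega)

end Counting

theorem eq_zero_of_forall_sum_mul_triangular {R : Type*} [Semiring R] {N : ℕ} {c : Fin N → R}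
    {a : Fin N → Fin N → R} (hlt : ∀ i m, m < i → a i m = 0) (hself : ∀ i, a i i = 1)
    (h : ∀ m, ∑ i, c i * a i m = 0) (m : Fin N) : c m = 0 := by
  induction m using WellFoundedLT.induction with
  | ind m ih =>
    have hm := h m
    rwa [Finset.sum_eq_single m (fun i _ hi => ?_) (fun hm => absurd (Finset.mem_univ m) hm),
      hself, mul_one] at hm
    rcases hi.lt_or_gt with hi | hi
    · rw [ih i hi, zero_mul]
    · rw [hlt i m hi, mul_zero]

/-- The `2n+1` functions `E_0^1, …, E_n^1, E_0^0, …, E_{n-1}^0`, as functions from the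
positive integers to `ℚ`, are linearly independent over `ℚ`. -/
theorem E_functions_linearIndependent (n : ℕ) (hn : 1 ≤ n) :
    LinearIndependent ℚ
      (Sum.elim
        (fun i : Fin (n + 1) => fun k : {k : ℕ // 1 ≤ k} => (Eone n i k : ℚ))
        (fun i : Fin n => fun k : {k : ℕ // 1 ≤ k} => (Ezero n i k : ℚ))) := by
  rw [Fintype.linearIndependent_iff]
  intro g hg
  have heval : ∀ k : ℕ, 1 ≤ k → ∑ i : Fin (n + 1), g (Sum.inl i) * (Eone n i k : ℚ) +
      ∑ i : Fin n, g (Sum.inr i) * (Ezero n i k : ℚ) = 0 := fun k hk => by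
    simpa [Fintype.sum_sum_type] using congrFun hg ⟨k, hk⟩
  have hl : ∀ i, g (Sum.inl i) = 0 := by
    refine eq_zero_of_forall_sum_mul_triangular
      (a := fun i m : Fin (n + 1) => (Eone n i (2 * m + 1) : ℚ)) (fun i m hm => ?_)
      (fun i => ?_) fun m => ?_
    · exact_mod_cast Eone_odd_eq_zero (Nat.lt_succ_iff.1 i.2) hm
    · exact_mod_cast Eone_odd_self (Nat.lt_succ_iff.1 i.2)
    · simpa [Ezero_odd_eq_zero] using heval (2 * m + 1) (by omega)
  have hr : ∀ i, g (Sum.inr i) = 0 := by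
    refine eq_zero_of_forall_sum_mul_triangular
      (a := fun i m : Fin n => (Ezero n i (2 * (m + 1)) : ℚ)) (fun i m hm => ?_)
      (fun i => ?_) fun m => ?_
    · exact_mod_cast Ezero_even_eq_zero i.2 hm
    · exact_mod_cast Ezero_even_self i.2
    · simpa [hl] using heval (2 * (m + 1)) (by omega)
  exact Sum.rec hl hr
end

section
/- Let q ≥ 1 and p be integers with gcd(p,q) = 1. The set of points of ½ℤ³ contained in T(p,q) consists exactly of: the four vertices (0,0,0), (1,0,0), (0,0,1), (p,q,1); the six midpoints of the edges of T(p,q); and the q−1 points a_i = ½(⌈ip/q⌉, i, 1) for i = 1, …, q−1. -/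
open Pointwise

/-- `T(p,q) = conv{(0,0,0), (1,0,0), (0,0,1), (p,q,1)}` in `ℝ³`. -/
def Tpq (p q : ℤ) : Set (Fin 3 → ℝ) :=
  convexHull ℝ
    {![0, 0, 0], ![1, 0, 0], ![0, 0, 1], ![(p : ℝ), (q : ℝ), 1]}

/-- The four vertices of `T(p,q)`. -/
noncomputable def TpqVertices (p q : ℤ) : Fin 4 → (Fin 3 → ℝ) :=
  ![![0, 0, 0], ![1, 0, 0], ![0, 0, 1], ![(p : ℝ), (q : ℝ), 1]]

/-- `T(p,q)` is cut out by four linear inequalities, one for each facet. -/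
theorem mem_Tpq_iff {p q : ℤ} (hq : 1 ≤ q) (x : Fin 3 → ℝ) :
    x ∈ Tpq p q ↔ 0 ≤ x 1 ∧ x 1 ≤ q * x 2 ∧ p * x 1 ≤ q * x 0 ∧
      q * x 0 - p * x 1 ≤ q * (1 - x 2) := by
  have hq0 : (0 : ℝ) < q := by exact_mod_cast hq
  constructor
  · intro hx
    refine convexHull_min (t := {x : Fin 3 → ℝ | 0 ≤ x 1 ∧ x 1 ≤ q * x 2 ∧ p * x 1 ≤ q * x 0 ∧
      q * x 0 - p * x 1 ≤ q * (1 - x 2)}) ?_ ?_ hx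
    · rintro y (rfl | rfl | rfl | rfl) <;> simp [hq0.le, mul_comm]
    · rintro u ⟨u1, u2, u3, u4⟩ v ⟨v1, v2, v3, v4⟩ a b ha hb hab
      obtain rfl : b = 1 - a := by linarith
      simp only [Set.mem_ofPred_eq, Pi.add_apply, Pi.smul_apply, smul_eq_mul]
      refine ⟨by positivity, ?_, ?_, ?_⟩
      · linarith [mul_le_mul_of_nonneg_left u2 ha, mul_le_mul_of_nonneg_left v2 hb]
      · linarith [mul_le_mul_of_nonneg_left u3 ha, mul_le_mul_of_nonneg_left v3 hb]
      · linarith [mul_le_mul_of_nonneg_left u4 ha, mul_le_mul_of_nonneg_left v4 hb]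
  · rintro ⟨h1, h2, h3, h4⟩
    refine mem_convexHull_of_exists_fintype
      ![1 - x 2 - (x 0 - p * (x 1 / q)), x 0 - p * (x 1 / q), x 2 - x 1 / q, x 1 / q]
      (TpqVertices p q) ?_ ?_ ?_ ?_
    · have e : x 1 = q * (x 1 / q) := by field_simp
      generalize x 1 / q = d at e ⊢
      rw [e] at h1 h2 h3 h4
      intro i
      fin_cases i
      · change 0 ≤ 1 - x 2 - (x 0 - p * d)
        exact nonneg_of_mul_nonneg_right (by linarith) hq0
      · change 0 ≤ x 0 - p * d
        exact nonneg_of_mul_nonneg_right (by linarith) hq0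
      · change 0 ≤ x 2 - d
        exact nonneg_of_mul_nonneg_right (by linarith) hq0
      · exact nonneg_of_mul_nonneg_right h1 hq0
    · simp [Fin.sum_univ_four]
    · intro i
      fin_cases i <;> simp [TpqVertices]
    · ext i
      fin_cases i <;> simp [Fin.sum_univ_four, TpqVertices] <;> field_simp
      ring

/-- The half-integer point `½(X, Y, Z)` lies in `T(p,q)` iff `(X, Y, Z)` satisfies four
integral inequalities. -/
theorem half_smul_mem_Tpq_iff {p q : ℤ} (hq : 1 ≤ q) (X Y Z : ℤ) :
    (2⁻¹ : ℝ) • ![(X : ℝ), (Y : ℝ), (Z : ℝ)] ∈ Tpq p q ↔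
      0 ≤ Y ∧ Y ≤ q * Z ∧ p * Y ≤ q * X ∧ q * X - p * Y ≤ q * (2 - Z) := by
  rw [mem_Tpq_iff hq]
  simp only [Pi.smul_apply, smul_eq_mul, Matrix.cons_val]
  rify
  constructor <;> rintro ⟨h1, h2, h3, h4⟩ <;> refine ⟨?_, ?_, ?_, ?_⟩ <;> linarith

theorem ceil_mul_div_eq_iff {q : ℤ} (hq : 1 ≤ q) (i p m : ℤ) :
    ⌈(i * p : ℚ) / (q : ℚ)⌉ = m ↔ p * i ≤ q * m ∧ q * m < p * i + q := by
  have hq0 : (0 : ℚ) < q := by exact_mod_cast hq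
  rw [Int.ceil_eq_iff, lt_div_iff₀ hq0, div_le_iff₀ hq0]
  qify
  constructor <;> rintro ⟨h1, h2⟩ <;> constructor <;> linarith

/-- The integral solutions of the inequalities of `half_smul_mem_Tpq_iff`. -/
theorem eq_of_half_smul_mem_Tpq {p q X Y Z : ℤ} (hq : 1 ≤ q) (hpq : IsCoprime p q)
    (h1 : 0 ≤ Y) (h2 : Y ≤ q * Z) (h3 : p * Y ≤ q * X) (h4 : q * X - p * Y ≤ q * (2 - Z)) :
    (Z = 0 ∧ Y = 0 ∧ (X = 0 ∨ X = 1 ∨ X = 2)) ∨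
    (Z = 2 ∧ ((X = 0 ∧ Y = 0) ∨ (X = p ∧ Y = q) ∨ (X = 2 * p ∧ Y = 2 * q))) ∨
    (Z = 1 ∧ ((Y = 0 ∧ (X = 0 ∨ X = 1)) ∨ (Y = q ∧ (X = p ∨ X = p + 1)) ∨
      (1 ≤ Y ∧ Y ≤ q - 1 ∧ q * X < p * Y + q))) := by
  have hq0 : 0 < q := hq
  have hZ0 : 0 ≤ Z := by
    by_contra! h
    nlinarith
  have hZ2 : Z ≤ 2 := by
    by_contra! h
    nlinarith
  obtain rfl | rfl | rfl : Z = 0 ∨ Z = 1 ∨ Z = 2 := by omega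
  · obtain rfl : Y = 0 := by omega
    have : 0 ≤ X := nonneg_of_mul_nonneg_right (by linarith) hq0
    have : X ≤ 2 := le_of_mul_le_mul_left (by linarith) hq0
    omega
  · right; right
    refine ⟨rfl, ?_⟩
    obtain rfl | rfl | ⟨hY1, hYq⟩ : Y = 0 ∨ Y = q ∨ (1 ≤ Y ∧ Y ≤ q - 1) := by omega
    · have : 0 ≤ X := nonneg_of_mul_nonneg_right (by linarith) hq0
      have : X ≤ 1 := le_of_mul_le_mul_left (by linarith) hq0
      omega
    · have : p ≤ X := le_of_mul_le_mul_left (by linarith) hq0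
      have : X ≤ p + 1 := le_of_mul_le_mul_left (by linarith) hq0
      omega
    · refine Or.inr (Or.inr ⟨hY1, hYq, lt_of_le_of_ne (by linarith) fun h => ?_⟩)
      have hdvd : q ∣ Y := hpq.symm.dvd_of_dvd_mul_left ⟨X - 1, by linarith⟩
      have := Int.le_of_dvd hY1 hdvd
      omega
  · right; left
    refine ⟨rfl, ?_⟩
    have hXY : p * Y = q * X := by linarith
    obtain ⟨k, rfl⟩ : q ∣ Y := hpq.symm.dvd_of_dvd_mul_left ⟨X, hXY⟩
    obtain rfl : X = p * k := mul_left_cancel₀ hq0.ne' (by linarith)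
    have : 0 ≤ k := nonneg_of_mul_nonneg_right h1 hq0
    have : k ≤ 2 := le_of_mul_le_mul_left h2 hq0
    obtain rfl | rfl | rfl : k = 0 ∨ k = 1 ∨ k = 2 := by omega
    · simp
    · simp
    · simp [mul_comm]

/-- The vertices of `T(p,q)`, as integral points. -/
def TpqIntVertices (p q : ℤ) : Fin 4 → (Fin 3 → ℤ) :=
  ![![0, 0, 0], ![1, 0, 0], ![0, 0, 1], ![p, q, 1]]

theorem TpqVertices_apply (p q : ℤ) (i : Fin 4) (k : Fin 3) :
    TpqVertices p q i k = (TpqIntVertices p q i k : ℝ) := by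
  fin_cases i <;> fin_cases k <;> simp [TpqVertices, TpqIntVertices]

theorem TpqVertices_mem (p q : ℤ) (i : Fin 4) : TpqVertices p q i ∈ Tpq p q := by
  refine subset_convexHull ℝ _ ?_
  fin_cases i <;> simp [TpqVertices]

/-- The half-integer points of `T(p,q)` are exactly its four vertices, the six midpoints of
its edges, and the `q-1` points `a_i = ½(⌈ip/q⌉, i, 1)`, `i = 1, …, q-1`. -/
theorem half_integer_points_of_Tpq (p q : ℤ) (hq : 1 ≤ q) (hpq : Int.gcd p q = 1) :
    {x : Fin 3 → ℝ | x ∈ Tpq p q ∧ ∀ i, ∃ m : ℤ, 2 * x i = (m : ℝ)} =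
      Set.range (TpqVertices p q) ∪
        {x | ∃ i j : Fin 4, i ≠ j ∧
          x = (2⁻¹ : ℝ) • (TpqVertices p q i + TpqVertices p q j)} ∪
        {x | ∃ i : ℤ, 1 ≤ i ∧ i ≤ q - 1 ∧
          x = (2⁻¹ : ℝ) • ![((⌈(i * p : ℚ) / (q : ℚ)⌉ : ℤ) : ℝ), (i : ℝ), 1]} := by
  ext x
  constructor
  · rintro ⟨hx, hint⟩
    choose m hm using hint
    obtain rfl : x = (2⁻¹ : ℝ) • ![(m 0 : ℝ), (m 1 : ℝ), (m 2 : ℝ)] := by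
      ext k
      fin_cases k <;> simp [← hm]
    clear hm
    obtain ⟨h1, h2, h3, h4⟩ := (half_smul_mem_Tpq_iff hq _ _ _).1 hx
    rcases eq_of_half_smul_mem_Tpq hq (Int.isCoprime_iff_gcd_eq_one.2 hpq) h1 h2 h3 h4 with
      ⟨hZ, hY, hX | hX | hX⟩ | ⟨hZ, ⟨hX, hY⟩ | ⟨hX, hY⟩ | ⟨hX, hY⟩⟩ |
      ⟨hZ, ⟨hY, hX | hX⟩ | ⟨hY, hX | hX⟩ | ⟨hY1, hYq, hlt⟩⟩
    · refine Or.inl (Or.inl ⟨0, ?_⟩)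
      ext k; fin_cases k <;> simp [TpqVertices, hX, hY, hZ]
    · refine Or.inl (Or.inr ⟨0, 1, by decide, ?_⟩)
      ext k; fin_cases k <;> simp [TpqVertices, hX, hY, hZ]
    · refine Or.inl (Or.inl ⟨1, ?_⟩)
      ext k; fin_cases k <;> simp [TpqVertices, hX, hY, hZ]
    · refine Or.inl (Or.inl ⟨2, ?_⟩)
      ext k; fin_cases k <;> simp [TpqVertices, hX, hY, hZ]
    · refine Or.inl (Or.inr ⟨2, 3, by decide, ?_⟩)
      ext k; fin_cases k <;> simp [TpqVertices, hX, hY, hZ, one_add_one_eq_two]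
    · refine Or.inl (Or.inl ⟨3, ?_⟩)
      ext k; fin_cases k <;> simp [TpqVertices, hX, hY, hZ]
    · refine Or.inl (Or.inr ⟨0, 2, by decide, ?_⟩)
      ext k; fin_cases k <;> simp [TpqVertices, hX, hY, hZ]
    · refine Or.inl (Or.inr ⟨1, 2, by decide, ?_⟩)
      ext k; fin_cases k <;> simp [TpqVertices, hX, hY, hZ]
    · refine Or.inl (Or.inr ⟨0, 3, by decide, ?_⟩)
      ext k; fin_cases k <;> simp [TpqVertices, hX, hY, hZ]
    · refine Or.inl (Or.inr ⟨1, 3, by decide, ?_⟩)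
      ext k; fin_cases k <;> simp [TpqVertices, hX, hY, hZ, add_comm]
    · refine Or.inr ⟨m 1, hY1, hYq, ?_⟩
      rw [hZ] at h4 ⊢
      rw [(ceil_mul_div_eq_iff hq _ _ (m 0)).2 ⟨h3, hlt⟩, Int.cast_one]
  · rintro ((⟨i, rfl⟩ | ⟨i, j, -, rfl⟩) | ⟨i, hi1, hiq, rfl⟩)
    · refine ⟨TpqVertices_mem p q i, fun k => ⟨2 * TpqIntVertices p q i k, ?_⟩⟩
      simp [TpqVertices_apply]
    · refine ⟨?_, fun k => ⟨TpqIntVertices p q i k + TpqIntVertices p q j k, ?_⟩⟩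
      · rw [smul_add]
        exact convex_convexHull ℝ _ (TpqVertices_mem p q i) (TpqVertices_mem p q j)
          (by norm_num) (by norm_num) (by norm_num)
      · simp [TpqVertices_apply]
    · obtain ⟨h3, h4⟩ := (ceil_mul_div_eq_iff hq i p _).1 rfl
      generalize ⌈(i * p : ℚ) / (q : ℚ)⌉ = c at h3 h4 ⊢
      constructor
      · rw [← Int.cast_one, half_smul_mem_Tpq_iff hq]
        refine ⟨?_, ?_, ?_, ?_⟩ <;> linarith
      · intro k
        refine ⟨![c, i, 1] k, ?_⟩
        fin_cases k <;> simp
end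

section
/- For every integer k ≥ 1, the number of points of ℤ³ in the relative interior of k·Δ'_2 equals (1/16)·(2k² − 6((−1)^k + 1)k + 9(−1)^k + 7). -/
open Pointwise

/-- `Δ'_2 = (½,½,0) + ½·conv(0, e_1, e_2)` in `ℝ³`. -/
noncomputable def Δ'two : Set (Fin 3 → ℝ) := (![1/2, 1/2, 0] : Fin 3 → ℝ) +ᵥ Δone 3 2

/-- `Δ'_3 = (½,½,0) + ½·conv(0, e_1, e_2, e_3)` in `ℝ³`. -/
noncomputable def Δ'three : Set (Fin 3 → ℝ) := (![1/2, 1/2, 0] : Fin 3 → ℝ) +ᵥ Δone 3 3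

theorem mem_baseSimplex_three_two {x : Fin 3 → ℝ} :
    x ∈ baseSimplex 3 2 ↔ x 2 = 0 ∧ 0 ≤ x 0 ∧ 0 ≤ x 1 ∧ x 0 + x 1 ≤ 1 := by
  constructor
  · intro hx
    have hconv : Convex ℝ {x : Fin 3 → ℝ | x 2 = 0 ∧ 0 ≤ x 0 ∧ 0 ≤ x 1 ∧ x 0 + x 1 ≤ 1} := by
      rintro x ⟨h1, h2, h3, h4⟩ y ⟨g1, g2, g3, g4⟩ a b ha hb hab
      simp only [Set.mem_ofPred_eq, Pi.add_apply, Pi.smul_apply, smul_eq_mul]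
      refine ⟨by simp [h1, g1], by positivity, by positivity, ?_⟩
      nlinarith [mul_le_mul_of_nonneg_left h4 ha, mul_le_mul_of_nonneg_left g4 hb]
    refine convexHull_min ?_ hconv hx
    rintro y (rfl | ⟨j, hj, rfl⟩)
    · simp
    · fin_cases j <;> simp at hj ⊢
  · rintro ⟨h1, h2, h3, h4⟩
    have hc := convex_convexHull ℝ
      (insert 0 ((fun j : Fin 3 => (Pi.single j 1 : Fin 3 → ℝ)) '' {j | (j : ℕ) < 2}))
    have hx : x = ∑ i : Fin 3, (![1 - x 0 - x 1, x 0, x 1] : Fin 3 → ℝ) i •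
        (![0, Pi.single 0 1, Pi.single 1 1] : Fin 3 → Fin 3 → ℝ) i := by
      ext i
      fin_cases i <;> simp [Fin.sum_univ_three, h1]
    rw [hx]
    refine hc.sum_mem (fun i _ => ?_) (by simp [Fin.sum_univ_three]; ring) (fun i _ => ?_)
    · fin_cases i <;> simp <;> linarith
    · refine subset_convexHull ℝ _ ?_
      fin_cases i
      · exact Or.inl rfl
      · exact Or.inr ⟨0, by simp, rfl⟩
      · exact Or.inr ⟨1, by simp, rfl⟩

theorem mem_smul_Δ'two {r : ℝ} (hr : 0 < r) {x : Fin 3 → ℝ} :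
    x ∈ r • Δ'two ↔ x 2 = 0 ∧ r ≤ 2 * x 0 ∧ r ≤ 2 * x 1 ∧ 2 * (x 0 + x 1) ≤ 3 * r := by
  rw [Set.mem_smul_set_iff_inv_smul_mem₀ hr.ne', Δ'two, Set.mem_vadd_set_iff_neg_vadd_mem, Δone,
    Set.mem_smul_set_iff_inv_smul_mem₀ (by norm_num), mem_baseSimplex_three_two]
  have key : ∀ y : ℝ, y = r * (r⁻¹ * y) := fun y => by field_simp
  simp only [inv_inv, vadd_eq_add, Pi.smul_apply, Pi.add_apply, Pi.neg_apply, smul_eq_mul,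
    Matrix.cons_val]
  have h0 := key (x 0)
  have h1 := key (x 1)
  refine and_congr (by simp [hr.ne']) (and_congr ?_ (and_congr ?_ ?_))
  · constructor <;> intro h <;> nlinarith
  · constructor <;> intro h <;> nlinarith
  · constructor <;> intro h <;> nlinarith

/-- A point of the relative interior of `s` can be pushed away from any point of `s`
without leaving `s`. -/
theorem exists_lineMap_mem_of_mem_intrinsicInterior {E : Type*} [AddCommGroup E] [Module ℝ E]
    [TopologicalSpace E] [IsTopologicalAddGroup E] [ContinuousSMul ℝ E] {s : Set E} {x y : E}
    (hx : x ∈ intrinsicInterior ℝ s) (hy : y ∈ s) :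
    ∃ t : ℝ, 1 < t ∧ AffineMap.lineMap y x t ∈ s := by
  obtain ⟨z, hz, rfl⟩ := hx
  have hmem : ∀ t : ℝ, AffineMap.lineMap y (z : E) t ∈ affineSpan ℝ s := fun t =>
    AffineMap.lineMap_mem t (subset_affineSpan ℝ s hy) z.2
  have hcont : Continuous fun t : ℝ => (⟨AffineMap.lineMap y (z : E) t, hmem t⟩ : affineSpan ℝ s) :=
    AffineMap.lineMap_continuous.subtype_mk hmem
  have hnhds : ∀ᶠ t in nhds (1 : ℝ), AffineMap.lineMap y (z : E) t ∈ s := by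
    refine hcont.continuousAt.eventually (p := fun w : affineSpan ℝ s => (w : E) ∈ s) ?_
    simpa using! mem_interior_iff_mem_nhds.1 hz
  obtain ⟨t, ht, ht1⟩ :=
    ((hnhds.filter_mono nhdsWithin_le_nhds).and (self_mem_nhdsWithin (s := Set.Ioi (1 : ℝ)))).exists
  exact ⟨t, ht1, ht⟩

theorem mem_intrinsicInterior_smul_Δ'two {r : ℝ} (hr : 0 < r) {x : Fin 3 → ℝ} :
    x ∈ intrinsicInterior ℝ (r • Δ'two) ↔
      x 2 = 0 ∧ r < 2 * x 0 ∧ r < 2 * x 1 ∧ 2 * (x 0 + x 1) < 3 * r := by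
  constructor
  · intro hx
    have hc : (![2 * r / 3, 2 * r / 3, 0] : Fin 3 → ℝ) ∈ r • Δ'two := by
      rw [mem_smul_Δ'two hr]
      simp only [Matrix.cons_val]
      refine ⟨trivial, ?_, ?_, ?_⟩ <;> linarith
    have hxs := (mem_smul_Δ'two hr).1 (intrinsicInterior_subset hx)
    obtain ⟨t, ht, hmem⟩ := exists_lineMap_mem_of_mem_intrinsicInterior hx hc
    rw [mem_smul_Δ'two hr] at hmem
    simp only [AffineMap.lineMap_apply, vsub_eq_sub, vadd_eq_add, Pi.smul_apply, Pi.add_apply,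
      Pi.sub_apply, smul_eq_mul, Matrix.cons_val] at hmem
    obtain ⟨-, h0, h1, h2⟩ := hmem
    refine ⟨hxs.1, ?_, ?_, ?_⟩ <;> by_contra! h <;> nlinarith
  · rintro ⟨h2, h0, h1, h3⟩
    have hxs : x ∈ r • Δ'two := (mem_smul_Δ'two hr).2 ⟨h2, h0.le, h1.le, h3.le⟩
    have hspan : ∀ y ∈ affineSpan ℝ (r • Δ'two), y 2 = 0 := by
      have hle : affineSpan ℝ (r • Δ'two) ≤
          (LinearMap.ker (LinearMap.proj (R := ℝ) (φ := fun _ : Fin 3 => ℝ) 2)).toAffineSubspace :=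
        affineSpan_le.2 fun y hy => ((mem_smul_Δ'two hr).1 hy).1
      exact fun y hy => hle hy
    refine ⟨⟨x, subset_affineSpan ℝ _ hxs⟩, ?_, rfl⟩
    refine mem_interior.2 ⟨{y | r < 2 * (y : Fin 3 → ℝ) 0 ∧ r < 2 * (y : Fin 3 → ℝ) 1 ∧
      2 * ((y : Fin 3 → ℝ) 0 + (y : Fin 3 → ℝ) 1) < 3 * r}, ?_, ?_, h0, h1, h3⟩
    · rintro y ⟨g0, g1, g3⟩
      exact (mem_smul_Δ'two hr).2 ⟨hspan y y.2, g0.le, g1.le, g3.le⟩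
    · have hcoord : ∀ i, Continuous fun y : affineSpan ℝ (r • Δ'two) => (y : Fin 3 → ℝ) i :=
        fun i => (continuous_apply i).comp continuous_subtype_val
      exact (isOpen_lt continuous_const ((hcoord 0).const_mul 2)).and
        ((isOpen_lt continuous_const ((hcoord 1).const_mul 2)).and
          (isOpen_lt (((hcoord 0).add (hcoord 1)).const_mul 2) continuous_const))

theorem two_mul_ncard_lattice_triangle (c : ℤ) (n : ℕ) :
    2 * Set.ncard {x : Fin 3 → ℤ | x 2 = 0 ∧ c ≤ x 0 ∧ c ≤ x 1 ∧ x 0 + x 1 < 2 * c + n} =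
      n * (n + 1) := by
  have hset : {x : Fin 3 → ℤ | x 2 = 0 ∧ c ≤ x 0 ∧ c ≤ x 1 ∧ x 0 + x 1 < 2 * c + n} =
      (fun p : (_ : ℕ) × ℕ => (![c + p.2, c + p.1 - p.2, 0] : Fin 3 → ℤ)) ''
        ((Finset.range n).sigma fun i => Finset.range (i + 1)) := by
    ext x
    simp only [Set.mem_ofPred_eq, Set.mem_image, Finset.mem_coe, Finset.mem_sigma, Finset.mem_range]
    constructor
    · rintro ⟨h2, h0, h1, h3⟩
      refine ⟨⟨(x 0 + x 1 - 2 * c).toNat, (x 0 - c).toNat⟩, by dsimp only; omega, ?_⟩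
      ext i
      fin_cases i <;> simp <;> omega
    · rintro ⟨⟨i, j⟩, ⟨hi, hj⟩, rfl⟩
      simp only [Matrix.cons_val, true_and]
      dsimp only at hi hj
      omega
  rw [hset, Set.ncard_image_of_injective, Set.ncard_coe_finset, Finset.card_sigma]
  · simp only [Finset.card_range]
    rw [← Finset.sum_range_succ' (fun i => i) n |>.trans (add_zero _), mul_comm,
      Finset.sum_range_id_mul_two, Nat.add_sub_cancel, mul_comm]
  · rintro ⟨i, j⟩ ⟨i', j'⟩ h
    have h0 := congrFun h 0
    have h1 := congrFun h 1
    simp only [Matrix.cons_val] at h0 h1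
    obtain rfl : j = j' := by omega
    obtain rfl : i = i' := by omega
    rfl

/-- Closed formula for the Ehrhart function of the relative interior of `Δ'_2`. -/
theorem E_Δ'two_formula (k : ℕ) (hk : 1 ≤ k) :
    (latticeCount (intrinsicInterior ℝ ((k : ℝ) • Δ'two)) : ℚ) =
      (1 / 16) * (2 * (k : ℚ) ^ 2 - 6 * ((-1 : ℚ) ^ k + 1) * k + 9 * (-1 : ℚ) ^ k + 7) := by
  have hr : (0 : ℝ) < k := by exact_mod_cast hk
  have hset : {x : Fin 3 → ℤ | (fun i => (x i : ℝ)) ∈ intrinsicInterior ℝ ((k : ℝ) • Δ'two)} =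
      {x | x 2 = 0 ∧ (k : ℤ) < 2 * x 0 ∧ (k : ℤ) < 2 * x 1 ∧ 2 * (x 0 + x 1) < 3 * (k : ℤ)} := by
    ext x
    rw [Set.mem_ofPred_eq, mem_intrinsicInterior_smul_Δ'two hr]
    norm_cast
  rw [latticeCount, hset]
  obtain ⟨m, rfl⟩ | ⟨m, rfl⟩ := k.even_or_odd
  · obtain ⟨n, rfl⟩ : ∃ n, m = n + 1 := ⟨m - 1, by omega⟩
    have hcount := two_mul_ncard_lattice_triangle (n + 2) (n - 1)
    have heq : {x : Fin 3 → ℤ | x 2 = 0 ∧ (n + 2 : ℤ) ≤ x 0 ∧ (n + 2 : ℤ) ≤ x 1 ∧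
          x 0 + x 1 < 2 * (n + 2 : ℤ) + (n - 1 : ℕ)} =
        {x | x 2 = 0 ∧ ((n + 1 + (n + 1) : ℕ) : ℤ) < 2 * x 0 ∧
          ((n + 1 + (n + 1) : ℕ) : ℤ) < 2 * x 1 ∧
          2 * (x 0 + x 1) < 3 * ((n + 1 + (n + 1) : ℕ) : ℤ)} := by
      ext x
      simp only [Set.mem_ofPred_eq]
      omega
    rw [heq] at hcount
    rw [Even.neg_one_pow ⟨n + 1, rfl⟩]
    have hn : (n - 1) * (n - 1 + 1) = n * (n - 1) := by cases n <;> simp [mul_comm]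
    have hcast : ((n * (n - 1) : ℕ) : ℚ) = n * (n - 1) := by cases n <;> simp
    have hQ := congrArg (Nat.cast : ℕ → ℚ) (hcount.trans hn)
    rw [hcast, Nat.cast_mul] at hQ
    push_cast at hQ ⊢
    linear_combination hQ / 2
  · have hcount := two_mul_ncard_lattice_triangle (m + 1) m
    have heq : {x : Fin 3 → ℤ | x 2 = 0 ∧ (m + 1 : ℤ) ≤ x 0 ∧ (m + 1 : ℤ) ≤ x 1 ∧
          x 0 + x 1 < 2 * (m + 1 : ℤ) + m} =
        {x | x 2 = 0 ∧ ((2 * m + 1 : ℕ) : ℤ) < 2 * x 0 ∧ ((2 * m + 1 : ℕ) : ℤ) < 2 * x 1 ∧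
          2 * (x 0 + x 1) < 3 * ((2 * m + 1 : ℕ) : ℤ)} := by
      ext x
      simp only [Set.mem_ofPred_eq]
      omega
    rw [heq] at hcount
    rw [Odd.neg_one_pow ⟨m, rfl⟩]
    have hQ := congrArg (Nat.cast : ℕ → ℚ) hcount
    push_cast at hQ ⊢
    linear_combination hQ / 2
end

section
/- If two polytopes P and P' in ℝ^d are GL(ℤ)-equidecomposable, then for every point λ ∈ ℚ^d the sets P ∩ Orb(λ) and P' ∩ Orb(λ) are finite and have the same cardinality, where Orb(λ) = {U(λ) : U a unimodular transformation of ℝ^d} is the orbit of λ under the group of unimodular transformations. -/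
open Pointwise

/-- A relatively open simplex: the relative interior of the convex hull of a set of
affinely independent points. -/
def IsRelOpenSimplex {n : ℕ} (T : Set (Fin n → ℝ)) : Prop :=
  ∃ s : Finset (Fin n → ℝ),
    AffineIndependent ℝ (fun p : (s : Set (Fin n → ℝ)) => (p : Fin n → ℝ)) ∧
    T = intrinsicInterior ℝ (convexHull ℝ (s : Set (Fin n → ℝ)))

/-- `P` and `Q` are GL(ℤ)-equidecomposable: they can be partitioned into relatively open
simplices `T_1, …, T_r` resp. `U_1(T_1), …, U_r(T_r)` with each `U_t` unimodular. -/
def GLZEquidecomposable {n : ℕ} (P Q : Set (Fin n → ℝ)) : Prop :=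
  ∃ (r : ℕ) (T : Fin r → Set (Fin n → ℝ)) (U : Fin r → (Fin n → ℝ) → (Fin n → ℝ)),
    (∀ t, IsRelOpenSimplex (T t)) ∧ (∀ t, IsUnimodular (U t)) ∧
    Pairwise (Function.onFun Disjoint T) ∧ P = ⋃ t, T t ∧
    Pairwise (Function.onFun Disjoint fun t => U t '' T t) ∧ Q = ⋃ t, U t '' T t

/-- The orbit of a rational point under the group of unimodular transformations. -/
def unimodularOrbit (d : ℕ) (lam : Fin d → ℚ) : Set (Fin d → ℝ) :=
  {x | ∃ f, IsUnimodular f ∧ x = f fun i => ((lam i : ℚ) : ℝ)}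

namespace IsUnimodular

variable {n : ℕ} {f g : (Fin n → ℝ) → (Fin n → ℝ)}

theorem comp (hf : IsUnimodular f) (hg : IsUnimodular g) : IsUnimodular (f ∘ g) := by
  obtain ⟨A, hA, a, hf⟩ := hf
  obtain ⟨B, hB, b, hg⟩ := hg
  refine ⟨A * B, by simpa [Matrix.det_mul] using And.intro hA hB, A.mulVec b + a, fun x => ?_⟩
  have hb : (A.map (Int.cast : ℤ → ℝ)).mulVec (fun i => (b i : ℝ)) =
      fun i => ((A.mulVec b i : ℤ) : ℝ) := by
    ext i
    simp [Matrix.mulVec, dotProduct]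
  have hAB : (A * B).map (Int.cast : ℤ → ℝ) = A.map Int.cast * B.map Int.cast :=
    Matrix.map_mul_intCast A B
  rw [Function.comp_apply, hf, hg, Matrix.mulVec_add, Matrix.mulVec_mulVec, hAB, hb, add_assoc]
  congr 1
  ext i
  simp

theorem exists_inverse (hf : IsUnimodular f) :
    ∃ g, IsUnimodular g ∧ Function.LeftInverse g f := by
  obtain ⟨A, hA, a, hf⟩ := hf
  refine ⟨fun x => (A⁻¹.map (Int.cast : ℤ → ℝ)).mulVec x +
      fun i => (((-(A⁻¹.mulVec a)) i : ℤ) : ℝ),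
    ⟨A⁻¹, Matrix.isUnit_nonsing_inv_det A hA, -(A⁻¹.mulVec a), fun _ => rfl⟩, fun x => ?_⟩
  have hmul : A⁻¹.map (Int.cast : ℤ → ℝ) * A.map Int.cast = 1 := by
    rw [← Matrix.map_mul_intCast, Matrix.nonsing_inv_mul A hA]
    simp
  have ha : (A⁻¹.map (Int.cast : ℤ → ℝ)).mulVec (fun i => (a i : ℝ)) =
      fun i => ((A⁻¹.mulVec a i : ℤ) : ℝ) := by
    ext i
    simp [Matrix.mulVec, dotProduct]
  simp only [hf, Matrix.mulVec_add, Matrix.mulVec_mulVec, hmul, ha, Matrix.one_mulVec]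
  ext i
  simp

theorem injective (hf : IsUnimodular f) : Function.Injective f :=
  let ⟨_, _, h⟩ := hf.exists_inverse
  h.injective

theorem apply_mem_unimodularOrbit_iff (hf : IsUnimodular f) {lam : Fin n → ℚ}
    {x : Fin n → ℝ} : f x ∈ unimodularOrbit n lam ↔ x ∈ unimodularOrbit n lam := by
  constructor
  · rintro ⟨u, hu, hx⟩
    obtain ⟨g, hg, hgf⟩ := hf.exists_inverse
    exact ⟨g ∘ u, hg.comp hu, by rw [Function.comp_apply, ← hx, hgf x]⟩
  · rintro ⟨u, hu, rfl⟩
    exact ⟨f ∘ u, hf.comp hu, rfl⟩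

theorem image_inter_unimodularOrbit (hf : IsUnimodular f) (T : Set (Fin n → ℝ))
    (lam : Fin n → ℚ) :
    f '' T ∩ unimodularOrbit n lam = f '' (T ∩ unimodularOrbit n lam) := by
  have h : f ⁻¹' unimodularOrbit n lam = unimodularOrbit n lam :=
    Set.ext fun _ => hf.apply_mem_unimodularOrbit_iff
  rw [← Set.image_inter_preimage, h]

end IsUnimodular

/-- The points of an orbit of a rational point have a common denominator. -/
theorem exists_common_denominator_unimodularOrbit {n : ℕ} (lam : Fin n → ℚ) :
    ∃ N : ℕ, 0 < N ∧ ∀ x ∈ unimodularOrbit n lam, ∃ z : Fin n → ℤ, ∀ i, (N : ℝ) * x i = z i := by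
  refine ⟨∏ i, (lam i).den, Finset.prod_pos fun i _ => (lam i).den_pos, ?_⟩
  set N := ∏ i, (lam i).den
  have hlam : ∀ i, ∃ k : ℤ, (N : ℝ) * (lam i : ℝ) = k := by
    intro i
    obtain ⟨m, hm⟩ : (lam i).den ∣ N := Finset.dvd_prod_of_mem _ (Finset.mem_univ i)
    refine ⟨m * (lam i).num, ?_⟩
    have h : (N : ℚ) * lam i = m * (lam i).num := by
      rw [hm, ← Rat.den_mul_eq_num (lam i)]
      push_cast
      ring
    exact_mod_cast h
  choose k hk using hlam
  rintro x ⟨f, ⟨A, -, b, hf⟩, rfl⟩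
  refine ⟨fun i => ∑ j, A i j * k j + N * b i, fun i => ?_⟩
  simp only [hf, Pi.add_apply, Matrix.mulVec, dotProduct, Matrix.map_apply, mul_add,
    Finset.mul_sum]
  push_cast
  congr 1
  refine Finset.sum_congr rfl fun j _ => ?_
  rw [← hk j]
  ring

/-- A bounded set contains finitely many points of each orbit of a rational point. -/
theorem Bornology.IsBounded.finite_inter_unimodularOrbit {n : ℕ} {P : Set (Fin n → ℝ)}
    (hP : Bornology.IsBounded P) (lam : Fin n → ℚ) : (P ∩ unimodularOrbit n lam).Finite := by
  obtain ⟨N, hN, hz⟩ := exists_common_denominator_unimodularOrbit lam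
  obtain ⟨R, hR⟩ := hP.exists_norm_le
  have hN' : (0 : ℝ) < N := Nat.cast_pos.2 hN
  refine ((Set.finite_Icc (fun _ : Fin n => -⌈N * R⌉) (fun _ => ⌈N * R⌉)).image
    fun z i => (z i : ℝ) / N).subset ?_
  rintro x ⟨hxP, hx⟩
  obtain ⟨z, hz⟩ := hz x hx
  have hle : ∀ i, |z i| ≤ ⌈N * R⌉ := by
    intro i
    have h : |(z i : ℝ)| ≤ ⌈N * R⌉ := by
      rw [← hz i, abs_mul, abs_of_pos hN']
      exact (mul_le_mul_of_nonneg_left ((norm_le_pi_norm x i).trans (hR x hxP)) hN'.le).trans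
        (Int.le_ceil _)
    exact_mod_cast h
  refine ⟨z, ⟨fun i => (abs_le.1 (hle i)).1, fun i => (abs_le.1 (hle i)).2⟩, ?_⟩
  ext i
  simp only [← hz i]
  field_simp

/-- Equidecomposable sets contain equally many points of each orbit of a rational point. -/
theorem GLZEquidecomposable.encard_inter_unimodularOrbit_eq {n : ℕ} {P Q : Set (Fin n → ℝ)}
    (h : GLZEquidecomposable P Q) (lam : Fin n → ℚ) :
    (P ∩ unimodularOrbit n lam).encard = (Q ∩ unimodularOrbit n lam).encard := by
  obtain ⟨r, T, U, -, hU, hT, rfl, hUT, rfl⟩ := h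
  simp only [Set.iUnion_inter]
  rw [Set.encard_iUnion_of_finite fun _ _ hij =>
      (hT hij).mono Set.inter_subset_left Set.inter_subset_left,
    Set.encard_iUnion_of_finite fun _ _ hij =>
      (hUT hij).mono Set.inter_subset_left Set.inter_subset_left]
  refine finsum_congr fun t => ?_
  rw [(hU t).image_inter_unimodularOrbit, (hU t).injective.encard_image]

/-- GL(ℤ)-equidecomposable polytopes contain the same (finite) number of points from every
orbit of a rational point under the group of unimodular transformations. -/
theorem equidecomposable_orbit_counts (d : ℕ) (P P' : Set (Fin d → ℝ))
    (hP : ∃ V : Finset (Fin d → ℝ), P = convexHull ℝ (V : Set (Fin d → ℝ)))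
    (hP' : ∃ V : Finset (Fin d → ℝ), P' = convexHull ℝ (V : Set (Fin d → ℝ)))
    (h : GLZEquidecomposable P P') (lam : Fin d → ℚ) :
    (P ∩ unimodularOrbit d lam).Finite ∧ (P' ∩ unimodularOrbit d lam).Finite ∧
      (P ∩ unimodularOrbit d lam).ncard = (P' ∩ unimodularOrbit d lam).ncard := by
  have hb : ∀ Q : Set (Fin d → ℝ),
      (∃ V : Finset (Fin d → ℝ), Q = convexHull ℝ (V : Set (Fin d → ℝ))) →
      Bornology.IsBounded Q := by
    rintro _ ⟨V, rfl⟩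
    exact isBounded_convexHull.2 V.finite_toSet.isBounded
  refine ⟨(hb P hP).finite_inter_unimodularOrbit lam,
    (hb P' hP').finite_inter_unimodularOrbit lam, ?_⟩
  rw [Set.ncard_def, Set.ncard_def, h.encard_inter_unimodularOrbit_eq lam]
end

section
/- The intervals Q' = [1/5, 6/5] and Q'' = [2/5, 7/5] in ℝ are Ehrhart-equivalent (for every integer k ≥ 1, |kQ' ∩ ℤ| = |kQ'' ∩ ℤ|), but they are not GL(ℤ)-equidecomposable. -/
open Pointwise

/-- A unimodular transformation of `ℝ`: `x ↦ εx + b` with `ε ∈ {1,-1}` and `b ∈ ℤ`. -/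
def IsUnimodular1 (f : ℝ → ℝ) : Prop :=
  ∃ ε : ℝ, (ε = 1 ∨ ε = -1) ∧ ∃ b : ℤ, ∀ x, f x = ε * x + (b : ℝ)

/-- A relatively open simplex in `ℝ`: a single point or an open bounded interval. -/
def IsRelOpenSimplex1 (T : Set ℝ) : Prop :=
  (∃ a : ℝ, T = {a}) ∨ ∃ a b : ℝ, a < b ∧ T = Set.Ioo a b

/-- GL(ℤ)-equidecomposability in `ℝ`. -/
def GLZEquidecomposable1 (P Q : Set ℝ) : Prop :=
  ∃ (r : ℕ) (T : Fin r → Set ℝ) (U : Fin r → ℝ → ℝ),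
    (∀ t, IsRelOpenSimplex1 (T t)) ∧ (∀ t, IsUnimodular1 (U t)) ∧
    Pairwise (Function.onFun Disjoint T) ∧ P = ⋃ t, T t ∧
    Pairwise (Function.onFun Disjoint fun t => U t '' T t) ∧ Q = ⋃ t, U t '' T t

/-- Integer points of the dilate `k • [a/5, b/5]`, as an interval of integers. -/
theorem setOf_intCast_mem_smul_Icc_div_five (k : ℕ) (hk : 1 ≤ k) (a b : ℤ) :
    {m : ℤ | (m : ℝ) ∈ (k : ℝ) • Set.Icc ((a : ℝ) / 5) ((b : ℝ) / 5)} =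
      (Finset.Icc ((k * a + 4) / 5) (k * b / 5) : Finset ℤ) := by
  have hk0 : (0 : ℝ) < k := by exact_mod_cast hk
  ext m
  have hl : (k : ℝ) * (a / 5) ≤ m ↔ k * a ≤ 5 * m := by
    rw [← Int.cast_le (R := ℝ)]
    push_cast
    constructor <;> intro h <;> linarith
  have hr : (m : ℝ) ≤ k * (b / 5) ↔ 5 * m ≤ k * b := by
    rw [← Int.cast_le (R := ℝ)]
    push_cast
    constructor <;> intro h <;> linarith
  rw [Set.mem_ofPred_eq, LinearOrderedField.smul_Icc hk0]
  simp only [Set.mem_Icc, Finset.coe_Icc, hl, hr]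
  omega

/-- Equidecomposable sets admit an injection that is pointwise unimodular. -/
theorem GLZEquidecomposable1.exists_injOn {P Q : Set ℝ} (h : GLZEquidecomposable1 P Q) :
    ∃ f : ℝ → ℝ, Set.MapsTo f P Q ∧ Set.InjOn f P ∧
      ∀ x ∈ P, ∃ g, IsUnimodular1 g ∧ f x = g x := by
  obtain ⟨r, T, U, -, hU, -, rfl, hdisj, rfl⟩ := h
  have hmem : ∀ x, ∃ y, x ∈ ⋃ t, T t → ∃ t, x ∈ T t ∧ y = U t x := by
    intro x
    by_cases hx : x ∈ ⋃ t, T t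
    · obtain ⟨t, ht⟩ := Set.mem_iUnion.1 hx
      exact ⟨U t x, fun _ => ⟨t, ht, rfl⟩⟩
    · exact ⟨0, fun h => absurd h hx⟩
  choose f hf using hmem
  refine ⟨f, fun x hx => ?_, fun x hx y hy hxy => ?_, fun x hx => ?_⟩
  · obtain ⟨t, ht, he⟩ := hf x hx
    exact Set.mem_iUnion.2 ⟨t, x, ht, he.symm⟩
  · obtain ⟨s, hs, hes⟩ := hf x hx
    obtain ⟨t, ht, het⟩ := hf y hy
    have himage : U s x = U t y := by rw [← hes, ← het, hxy]
    obtain rfl : s = t := by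
      by_contra hst
      exact Set.disjoint_left.1 (hdisj hst) ⟨x, hs, rfl⟩ ⟨y, ht, himage.symm⟩
    obtain ⟨ε, hε, b, hb⟩ := hU s
    rw [hb, hb] at himage
    rcases hε with rfl | rfl <;> linarith
  · obtain ⟨t, -, he⟩ := hf x hx
    exact ⟨U t, hU t, he⟩

/-- The only points of `[2/5, 7/5]` congruent to `±1/5` modulo `1` are `4/5` and `6/5`. -/
theorem eq_or_eq_of_isUnimodular1 {g : ℝ → ℝ} (hg : IsUnimodular1 g) {x : ℝ}
    (hx : x = 1 / 5 ∨ x = 4 / 5 ∨ x = 6 / 5) (hgx : g x ∈ Set.Icc (2 / 5 : ℝ) (7 / 5)) :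
    g x = 4 / 5 ∨ g x = 6 / 5 := by
  obtain ⟨ε, hε, b, hb⟩ := hg
  rw [hb] at hgx ⊢
  obtain ⟨h₁, h₂⟩ := hgx
  have hlow : (-3 : ℤ) < b := by
    rw [← Int.cast_lt (R := ℝ)]
    push_cast
    rcases hε with rfl | rfl <;> rcases hx with rfl | rfl | rfl <;> linarith
  have hupp : b < (4 : ℤ) := by
    rw [← Int.cast_lt (R := ℝ)]
    push_cast
    rcases hε with rfl | rfl <;> rcases hx with rfl | rfl | rfl <;> linarith
  rcases hε with rfl | rfl <;> rcases hx with rfl | rfl | rfl <;> interval_cases b <;>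
    first | (exfalso; norm_num at h₁; done) | (exfalso; norm_num at h₂; done) | norm_num

/-- The intervals `[1/5, 6/5]` and `[2/5, 7/5]` are Ehrhart-equivalent but not
GL(ℤ)-equidecomposable. -/
theorem intervals_ehrhart_equivalent_not_equidecomposable :
    (∀ k : ℕ, 1 ≤ k →
      {m : ℤ | (m : ℝ) ∈ (k : ℝ) • Set.Icc (1 / 5 : ℝ) (6 / 5)}.ncard =
        {m : ℤ | (m : ℝ) ∈ (k : ℝ) • Set.Icc (2 / 5 : ℝ) (7 / 5)}.ncard) ∧
    ¬ GLZEquidecomposable1 (Set.Icc (1 / 5 : ℝ) (6 / 5)) (Set.Icc (2 / 5 : ℝ) (7 / 5)) := by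
  refine ⟨fun k hk => ?_, fun h => ?_⟩
  · have h₁ := setOf_intCast_mem_smul_Icc_div_five k hk 1 6
    have h₂ := setOf_intCast_mem_smul_Icc_div_five k hk 2 7
    push_cast at h₁ h₂
    rw [h₁, h₂, ← Finset.coe_Icc, ← Finset.coe_Icc, Set.ncard_coe_finset, Set.ncard_coe_finset,
      Int.card_Icc, Int.card_Icc]
    have hmod : k % 5 = 0 ∨ k % 5 = 1 ∨ k % 5 = 2 ∨ k % 5 = 3 ∨ k % 5 = 4 := by omega
    rcases hmod with h | h | h | h | h <;> omega
  · obtain ⟨f, hmaps, hinj, hf⟩ := h.exists_injOn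
    have hval : ∀ x, x = 1 / 5 ∨ x = 4 / 5 ∨ x = 6 / 5 →
        x ∈ Set.Icc (1 / 5 : ℝ) (6 / 5) ∧ (f x = 4 / 5 ∨ f x = 6 / 5) := by
      intro x hx
      have hmem : x ∈ Set.Icc (1 / 5 : ℝ) (6 / 5) := by
        rcases hx with rfl | rfl | rfl <;> constructor <;> norm_num
      obtain ⟨g, hg, he⟩ := hf x hmem
      have hQ := hmaps hmem
      rw [he] at hQ ⊢
      exact ⟨hmem, eq_or_eq_of_isUnimodular1 hg hx hQ⟩
    obtain ⟨m₁, v₁⟩ := hval (1 / 5) (by simp)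
    obtain ⟨m₂, v₂⟩ := hval (4 / 5) (by simp)
    obtain ⟨m₃, v₃⟩ := hval (6 / 5) (by simp)
    have n₁₂ : f (1 / 5) ≠ f (4 / 5) := fun e => by
      have := hinj m₁ m₂ e
      norm_num at this
    have n₁₃ : f (1 / 5) ≠ f (6 / 5) := fun e => by
      have := hinj m₁ m₃ e
      norm_num at this
    have n₂₃ : f (4 / 5) ≠ f (6 / 5) := fun e => by
      have := hinj m₂ m₃ e
      norm_num at this
    grind
end
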